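/- Let ε > 0, let φ and B be C^∞ functions on [0,ε), let λ ≥ 0 and c₀ > 0, and assume φ(x) > 0 and λφ(x) + B(x) ≥ c₀ for all x ∈ [0,ε). There exist T₀ ∈ (0, ε/2] and C > 0, depending only on φ, B, λ, c₀, with the following property. Let 0 < T ≤ T₀, let G be measurable on Ω_T = (0,T)×(0,T) with |||G|||_{0,2} < ∞, and let W be a C^∞ function on Ω_T satisfying (μ+ν)² ∂_μ∂_ν W − (λ φ(2μν/(μ+ν)) + B(2μν/(μ+ν))) W = G on Ω_T, whose diagonal traces q₁(μ) = W(μ,μ) and q₂(μ) = (∂_μ W)(μ,μ) satisfy ‖q₁‖_{2,3/2} < ∞ and ‖q₂‖_{2,3/2} < ∞. Then ∫_{Ω_T} [ (μ+ν)^{-2} ( μ (∂_μ W)² + ν (∂_ν W)² ) + (μ+ν)^{-3} (λ+1) W² ] dμ dν ≤ C T (‖q₁‖_{2,3/2}² + ‖q₂‖_{2,3/2}² + |||G|||_{0,2}²). -/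

import Mathlib

open MeasureTheory Set ENNReal

/-- The weighted Sobolev norm squared
`‖q‖_{s,j}² = Σ_{i=0}^{s} ∫_0^T |(d/dμ)^i (μ^{-j} q(μ))|² dμ`, valued in `[0,∞]`. -/
noncomputable def sobNormSq (T : ℝ) (s : ℕ) (j : ℝ) (q : ℝ → ℝ) : ℝ≥0∞ :=
  ∑ i ∈ Finset.range (s + 1),
    ∫⁻ μ in Ioo (0 : ℝ) T, ENNReal.ofReal ((iteratedDeriv i (fun t => t ^ (-j) * q t) μ) ^ 2)

/-- The weighted norm squared `|||G|||_{0,j}² = ∫_{Ω_T} (μ+ν)^{-2j} G(μ,ν)² dμ dν`,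
valued in `[0,∞]`. -/
noncomputable def srcNormSq (T : ℝ) (j : ℝ) (G : ℝ → ℝ → ℝ) : ℝ≥0∞ :=
  ∫⁻ p in Ioo (0 : ℝ) T ×ˢ Ioo (0 : ℝ) T,
    ENNReal.ofReal ((p.1 + p.2) ^ (-(2 * j)) * (G p.1 p.2) ^ 2)

/-- The closed triangle `α ≤ ν ≤ μ ≤ β` below the diagonal. -/
def lowerTriangle (α β : ℝ) : Set (ℝ × ℝ) := {z | α ≤ z.2 ∧ z.2 ≤ z.1 ∧ z.1 ≤ β}

lemma isCompact_lowerTriangle (α β : ℝ) : IsCompact (lowerTriangle α β) := by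
  refine (isCompact_Icc (a := α) (b := β)).prod (isCompact_Icc (a := α) (b := β))
    |>.of_isClosed_subset ?_ ?_
  · exact (isClosed_le continuous_const continuous_snd).inter
      ((isClosed_le continuous_snd continuous_fst).inter
        (isClosed_le continuous_fst continuous_const))
  · rintro ⟨x, y⟩ ⟨h1, h2, h3⟩
    exact ⟨⟨h1.trans h2, h3⟩, ⟨h1, h2.trans h3⟩⟩

lemma lowerTriangle_subset_square {α β T : ℝ} (hα : 0 < α) (hβ : β < T) :
    lowerTriangle α β ⊆ Ioo 0 T ×ˢ Ioo 0 T := by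
  rintro ⟨x, y⟩ ⟨h1, h2, h3⟩
  simp only at h1 h2 h3
  exact ⟨⟨by linarith, by linarith⟩, ⟨by linarith, by linarith⟩⟩

lemma integral_lowerTriangle_deriv_fst {α β : ℝ} (hαβ : α ≤ β) {A A' : ℝ → ℝ → ℝ}
    (hc : ContinuousOn (fun z : ℝ × ℝ => A' z.1 z.2) (lowerTriangle α β))
    (hd : ∀ x y, (x, y) ∈ lowerTriangle α β → HasDerivAt (fun s => A s y) (A' x y) x) :
    ∫ z in lowerTriangle α β, A' z.1 z.2 = ∫ t in α..β, (A β t - A t t) := by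
  have hK := isCompact_lowerTriangle α β
  have hm := hK.measurableSet
  rw [← integral_indicator hm, Measure.volume_eq_prod, integral_prod_symm _
    ((integrable_indicator_iff hm).2 (hc.integrableOn_compact hK)),
    intervalIntegral.integral_of_le hαβ, ← integral_Icc_eq_integral_Ioc,
    ← integral_indicator measurableSet_Icc]
  congr 1
  ext y
  by_cases hy : y ∈ Icc α β
  · rw [indicator_of_mem hy, ← intervalIntegral.integral_eq_sub_of_hasDerivAt
      (f := fun s => A s y) (f' := fun s => A' s y),
      intervalIntegral.integral_of_le hy.2, ← integral_Icc_eq_integral_Ioc,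
      ← integral_indicator measurableSet_Icc]
    · congr 1
      ext x
      by_cases hx : x ∈ Icc y β
      · rw [indicator_of_mem hx, indicator_of_mem]
        exact ⟨hy.1, hx⟩
      · rw [indicator_of_notMem hx, indicator_of_notMem]
        exact fun h => hx h.2
    · intro x hx
      rw [uIcc_of_le hy.2] at hx
      exact hd x y ⟨hy.1, hx⟩
    · refine ContinuousOn.intervalIntegrable ?_
      rw [uIcc_of_le hy.2]
      exact hc.comp (f := fun x => (x, y)) (by fun_prop) fun x hx => ⟨hy.1, hx⟩
  · rw [indicator_of_notMem hy]
    refine (integral_congr_ae (.of_forall fun x => ?_)).trans (integral_zero _ _)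
    exact indicator_of_notMem (fun h => hy ⟨h.1, h.2.1.trans h.2.2⟩) _

lemma integral_lowerTriangle_deriv_snd {α β : ℝ} (hαβ : α ≤ β) {A A' : ℝ → ℝ → ℝ}
    (hc : ContinuousOn (fun z : ℝ × ℝ => A' z.1 z.2) (lowerTriangle α β))
    (hd : ∀ x y, (x, y) ∈ lowerTriangle α β → HasDerivAt (A x) (A' x y) y) :
    ∫ z in lowerTriangle α β, A' z.1 z.2 = ∫ t in α..β, (A t t - A t α) := by
  have hK := isCompact_lowerTriangle α β
  have hm := hK.measurableSet
  rw [← integral_indicator hm, Measure.volume_eq_prod, integral_prod _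
    ((integrable_indicator_iff hm).2 (hc.integrableOn_compact hK)),
    intervalIntegral.integral_of_le hαβ, ← integral_Icc_eq_integral_Ioc,
    ← integral_indicator measurableSet_Icc]
  congr 1
  ext x
  by_cases hx : x ∈ Icc α β
  · rw [indicator_of_mem hx, ← intervalIntegral.integral_eq_sub_of_hasDerivAt
      (f := A x) (f' := A' x),
      intervalIntegral.integral_of_le hx.1, ← integral_Icc_eq_integral_Ioc,
      ← integral_indicator measurableSet_Icc]
    · congr 1
      ext y
      by_cases hy : y ∈ Icc α x
      · rw [indicator_of_mem hy, indicator_of_mem]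
        exact ⟨hy.1, hy.2, hx.2⟩
      · rw [indicator_of_notMem hy, indicator_of_notMem]
        exact fun h => hy ⟨h.1, h.2.1⟩
    · intro y hy
      rw [uIcc_of_le hx.1] at hy
      exact hd x y ⟨hy.1, hy.2, hx.2⟩
    · refine ContinuousOn.intervalIntegrable ?_
      rw [uIcc_of_le hx.1]
      exact hc.comp (f := fun y => (x, y)) (by fun_prop) fun y hy => ⟨hy.1, hy.2, hx.2⟩
  · rw [indicator_of_notMem hx]
    refine (integral_congr_ae (.of_forall fun y => ?_)).trans (integral_zero _ _)
    exact indicator_of_notMem (fun h => hx ⟨h.1.trans h.2.1, h.2.2⟩) _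

/-- If the flux `(A, B)` points outwards along the two legs of a triangle, then the integral of its
divergence is bounded below by the flux through the hypotenuse. -/
lemma integral_diagonal_flux_le {α β : ℝ} (hαβ : α ≤ β) {A A' B B' : ℝ → ℝ → ℝ}
    (hA : ContinuousOn (fun z : ℝ × ℝ => A z.1 z.2) (lowerTriangle α β))
    (hB : ContinuousOn (fun z : ℝ × ℝ => B z.1 z.2) (lowerTriangle α β))
    (hA' : ContinuousOn (fun z : ℝ × ℝ => A' z.1 z.2) (lowerTriangle α β))
    (hB' : ContinuousOn (fun z : ℝ × ℝ => B' z.1 z.2) (lowerTriangle α β))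
    (hdA : ∀ x y, (x, y) ∈ lowerTriangle α β → HasDerivAt (fun s => A s y) (A' x y) x)
    (hdB : ∀ x y, (x, y) ∈ lowerTriangle α β → HasDerivAt (B x) (B' x y) y)
    (hA0 : ∀ t ∈ Icc α β, 0 ≤ A β t) (hB0 : ∀ t ∈ Icc α β, B t α ≤ 0) :
    ∫ t in α..β, (B t t - A t t) ≤
      ∫ z in lowerTriangle α β, (A' z.1 z.2 + B' z.1 z.2) := by
  have hK := isCompact_lowerTriangle α β
  have hdiag : ∀ {H : ℝ → ℝ → ℝ},
      ContinuousOn (fun z : ℝ × ℝ => H z.1 z.2) (lowerTriangle α β) →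
      ContinuousOn (fun t => H t t) (Icc α β) := fun h =>
    h.comp (f := fun t => (t, t)) (by fun_prop) fun t ht => ⟨ht.1, le_rfl, ht.2⟩
  have hAβ : ContinuousOn (fun t => A β t) (Icc α β) :=
    hA.comp (f := fun t => (β, t)) (by fun_prop) fun t ht => ⟨ht.1, ht.2, le_rfl⟩
  have hBα : ContinuousOn (fun t => B t α) (Icc α β) :=
    hB.comp (f := fun t => (t, α)) (by fun_prop) fun t ht => ⟨le_rfl, ht.1, ht.2⟩
  have hAd := hdiag hA
  have hBd := hdiag hB
  rw [integral_add (hA'.integrableOn_compact hK) (hB'.integrableOn_compact hK),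
    integral_lowerTriangle_deriv_fst hαβ hA' hdA, integral_lowerTriangle_deriv_snd hαβ hB' hdB]
  rw [← uIcc_of_le hαβ] at hAβ hBα hAd hBd
  have hAi : IntervalIntegrable (fun t => A β t - A t t) volume α β :=
    (hAβ.sub hAd).intervalIntegrable
  have hBi : IntervalIntegrable (fun t => B t t - B t α) volume α β :=
    (hBd.sub hBα).intervalIntegrable
  rw [← intervalIntegral.integral_add hAi hBi]
  refine intervalIntegral.integral_mono_on hαβ (hBd.sub hAd).intervalIntegrable (hAi.add hBi)
    fun t ht => ?_
  linarith [hA0 t ht, hB0 t ht]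

/-- `p`, `q` and `w` are the continuous partial derivatives `∂_μ W`, `∂_ν W` and `∂_μ ∂_ν W` of the
continuous function `W` on `s`. -/
structure HasMixedPartialsOn (s : Set (ℝ × ℝ)) (W p q w : ℝ → ℝ → ℝ) : Prop where
  continuousOn : ContinuousOn (fun z : ℝ × ℝ => W z.1 z.2) s
  continuousOn_fst : ContinuousOn (fun z : ℝ × ℝ => p z.1 z.2) s
  continuousOn_snd : ContinuousOn (fun z : ℝ × ℝ => q z.1 z.2) s
  continuousOn_mixed : ContinuousOn (fun z : ℝ × ℝ => w z.1 z.2) s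
  hasDerivAt_fst : ∀ x y, (x, y) ∈ s → HasDerivAt (fun t => W t y) (p x y) x
  hasDerivAt_snd : ∀ x y, (x, y) ∈ s → HasDerivAt (W x) (q x y) y
  hasDerivAt_fst_snd : ∀ x y, (x, y) ∈ s → HasDerivAt (p x) (w x y) y
  hasDerivAt_snd_fst : ∀ x y, (x, y) ∈ s → HasDerivAt (fun t => q t y) (w x y) x

lemma HasMixedPartialsOn.mono {s t : Set (ℝ × ℝ)} {W p q w : ℝ → ℝ → ℝ}
    (h : HasMixedPartialsOn s W p q w) (hts : t ⊆ s) : HasMixedPartialsOn t W p q w where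
  continuousOn := h.continuousOn.mono hts
  continuousOn_fst := h.continuousOn_fst.mono hts
  continuousOn_snd := h.continuousOn_snd.mono hts
  continuousOn_mixed := h.continuousOn_mixed.mono hts
  hasDerivAt_fst x y hz := h.hasDerivAt_fst x y (hts hz)
  hasDerivAt_snd x y hz := h.hasDerivAt_snd x y (hts hz)
  hasDerivAt_fst_snd x y hz := h.hasDerivAt_fst_snd x y (hts hz)
  hasDerivAt_snd_fst x y hz := h.hasDerivAt_snd_fst x y (hts hz)

lemma HasMixedPartialsOn.swap {I : Set ℝ} {W p q w : ℝ → ℝ → ℝ}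
    (h : HasMixedPartialsOn (I ×ˢ I) W p q w) :
    HasMixedPartialsOn (I ×ˢ I) (fun x y => W y x) (fun x y => q y x) (fun x y => p y x)
      (fun x y => w y x) := by
  have hs : MapsTo Prod.swap (I ×ˢ I) (I ×ˢ I) := fun z hz => ⟨hz.2, hz.1⟩
  exact
    { continuousOn := h.continuousOn.comp continuous_swap.continuousOn hs
      continuousOn_fst := h.continuousOn_snd.comp continuous_swap.continuousOn hs
      continuousOn_snd := h.continuousOn_fst.comp continuous_swap.continuousOn hs
      continuousOn_mixed := h.continuousOn_mixed.comp continuous_swap.continuousOn hs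
      hasDerivAt_fst := fun x y hz => h.hasDerivAt_snd y x (hs hz)
      hasDerivAt_snd := fun x y hz => h.hasDerivAt_fst y x (hs hz)
      hasDerivAt_fst_snd := fun x y hz => h.hasDerivAt_snd_fst y x (hs hz)
      hasDerivAt_snd_fst := fun x y hz => h.hasDerivAt_fst_snd y x (hs hz) }

lemma ContDiffOn.hasMixedPartialsOn {s : Set (ℝ × ℝ)} (hs : IsOpen s) {W : ℝ → ℝ → ℝ}
    (hW : ContDiffOn ℝ 2 (fun z : ℝ × ℝ => W z.1 z.2) s) :
    HasMixedPartialsOn s W (fun x y => deriv (fun t => W t y) x) (fun x y => deriv (W x) y)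
      (fun x y => deriv (fun t => deriv (fun r => W t r) y) x) := by
  set U : ℝ × ℝ → ℝ := fun z => W z.1 z.2 with hU
  have hU1 : ContDiffOn ℝ 1 (fderiv ℝ U) s := hW.fderiv_of_isOpen hs (by norm_num)
  have hU2 : ContinuousOn (fderiv ℝ (fderiv ℝ U)) s := hU1.continuousOn_fderiv_of_isOpen hs le_rfl
  have hd : ∀ z ∈ s, HasFDerivAt U (fderiv ℝ U z) z := fun z hz =>
    ((hW.differentiableOn (by norm_num) z hz).differentiableAt (hs.mem_nhds hz)).hasFDerivAt
  have hdd : ∀ z ∈ s, HasFDerivAt (fderiv ℝ U) (fderiv ℝ (fderiv ℝ U) z) z := fun z hz =>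
    ((hU1.differentiableOn (by norm_num) z hz).differentiableAt (hs.mem_nhds hz)).hasFDerivAt
  have hsx : ∀ x y : ℝ, HasDerivAt (fun t => (t, y)) ((1 : ℝ), (0 : ℝ)) x := fun x y =>
    (hasDerivAt_id x).prodMk (hasDerivAt_const x y)
  have hsy : ∀ x y : ℝ, HasDerivAt (fun t => (x, t)) ((0 : ℝ), (1 : ℝ)) y := fun x y =>
    (hasDerivAt_const y x).prodMk (hasDerivAt_id y)
  have h1 : ∀ x y, (x, y) ∈ s → HasDerivAt (fun t => W t y) (fderiv ℝ U (x, y) (1, 0)) x :=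
    fun x y hz => HasFDerivAt.comp_hasDerivAt (f := fun t => (t, y)) x (hd (x, y) hz) (hsx x y)
  have h2 : ∀ x y, (x, y) ∈ s → HasDerivAt (W x) (fderiv ℝ U (x, y) (0, 1)) y :=
    fun x y hz => HasFDerivAt.comp_hasDerivAt (f := fun t => (x, t)) y (hd (x, y) hz) (hsy x y)
  have h12 : ∀ x y, (x, y) ∈ s → HasDerivAt (fun t => fderiv ℝ U (x, t) (1, 0))
      (fderiv ℝ (fderiv ℝ U) (x, y) (0, 1) (1, 0)) y := fun x y hz =>
    (HasFDerivAt.comp_hasDerivAt (f := fun t => (x, t)) y (hdd (x, y) hz) (hsy x y)).clm_apply (hasDerivAt_const y _) |>.congr_deriv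
      (by simp)
  have h21 : ∀ x y, (x, y) ∈ s → HasDerivAt (fun t => fderiv ℝ U (t, y) (0, 1))
      (fderiv ℝ (fderiv ℝ U) (x, y) (1, 0) (0, 1)) x := fun x y hz =>
    (HasFDerivAt.comp_hasDerivAt (f := fun t => (t, y)) x (hdd (x, y) hz) (hsx x y)).clm_apply (hasDerivAt_const x _) |>.congr_deriv
      (by simp)
  have hsymm : ∀ x y, (x, y) ∈ s → fderiv ℝ (fderiv ℝ U) (x, y) (0, 1) (1, 0)
      = fderiv ℝ (fderiv ℝ U) (x, y) (1, 0) (0, 1) := fun x y hz =>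
    ((hW.contDiffAt (hs.mem_nhds hz)).isSymmSndFDerivAt (by simp)).eq _ _
  have hx : ∀ x y, (x, y) ∈ s → ∀ᶠ t in nhds x, (t, y) ∈ s := fun x y hz =>
    (hsx x y).continuousAt.preimage_mem_nhds (hs.mem_nhds hz)
  have hy : ∀ x y, (x, y) ∈ s → ∀ᶠ t in nhds y, (x, t) ∈ s := fun x y hz =>
    (hsy x y).continuousAt.preimage_mem_nhds (hs.mem_nhds hz)
  have h21' : ∀ x y, (x, y) ∈ s → HasDerivAt (fun t => deriv (W t) y)
      (fderiv ℝ (fderiv ℝ U) (x, y) (1, 0) (0, 1)) x := fun x y hz =>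
    (h21 x y hz).congr_of_eventuallyEq ((hx x y hz).mono fun t ht => (h2 t y ht).deriv)
  refine ⟨hW.continuousOn, ?_, ?_, ?_, fun x y hz => ?_, fun x y hz => ?_, fun x y hz => ?_,
    fun x y hz => ?_⟩
  · exact (hU1.continuousOn.clm_apply continuousOn_const).congr fun z hz => (h1 z.1 z.2 hz).deriv
  · exact (hU1.continuousOn.clm_apply continuousOn_const).congr fun z hz => (h2 z.1 z.2 hz).deriv
  · exact ((hU2.clm_apply continuousOn_const).clm_apply continuousOn_const).congr
      fun z hz => (h21' z.1 z.2 hz).deriv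
  · simpa only [(h1 x y hz).deriv] using h1 x y hz
  · simpa only [(h2 x y hz).deriv] using h2 x y hz
  · have h := (h12 x y hz).congr_of_eventuallyEq
      ((hy x y hz).mono fun t ht => (h1 x t ht).deriv)
    simpa only [(h21' x y hz).deriv, ← hsymm x y hz] using h
  · simpa only [(h21' x y hz).deriv] using h21' x y hz

/-- The zeroth order coefficient `P(2μν/(μ+ν)) / (μ+ν)²` of the wave equation. -/
noncomputable def wavePotential (P : ℝ → ℝ) (x y : ℝ) : ℝ := P (2 * x * y / (x + y)) / (x + y) ^ 2

lemma wavePotential_comm (P : ℝ → ℝ) (x y : ℝ) : wavePotential P x y = wavePotential P y x := by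
  simp only [wavePotential, add_comm x y, mul_right_comm 2 x y]

lemma wavePotential_nonneg {P : ℝ → ℝ} {x y : ℝ} (h : 0 ≤ P (2 * x * y / (x + y))) :
    0 ≤ wavePotential P x y := div_nonneg h (sq_nonneg _)

lemma harmonicMean_mem_Ioo {T x y : ℝ} (hx : x ∈ Ioo 0 T) (hy : y ∈ Ioo 0 T) :
    2 * x * y / (x + y) ∈ Ioo 0 T := by
  obtain ⟨hx0, hxT⟩ := hx
  obtain ⟨hy0, hyT⟩ := hy
  refine ⟨by positivity, ?_⟩
  rw [div_lt_iff₀ (by positivity)]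
  nlinarith [mul_lt_mul_of_pos_right hxT hy0, mul_lt_mul_of_pos_right hyT hx0]

lemma hasDerivAt_wavePotential_fst {P : ℝ → ℝ} {d x y : ℝ} (hx : 0 < x) (hy : 0 < y)
    (hP : HasDerivAt P d (2 * x * y / (x + y))) :
    HasDerivAt (fun t => wavePotential P t y)
      (2 * d * y ^ 2 / (x + y) ^ 4 - 2 * P (2 * x * y / (x + y)) / (x + y) ^ 3) x := by
  have hr : x + y ≠ 0 := by positivity
  have h1 : HasDerivAt (fun t : ℝ => t + y) 1 x := (hasDerivAt_id x).add_const y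
  have h2 : HasDerivAt (fun t : ℝ => 2 * t * y) (2 * y) x := by
    simpa using ((hasDerivAt_id x).const_mul 2).mul_const y
  have h3 := HasDerivAt.comp (h := fun t : ℝ => 2 * t * y / (t + y)) x hP (h2.div h1 hr)
  refine (h3.div (h1.pow 2) (pow_ne_zero 2 hr)).congr_deriv ?_
  simp only [Function.comp_apply, Pi.pow_apply]
  field_simp
  ring

lemma hasDerivAt_wavePotential_snd {P : ℝ → ℝ} {d x y : ℝ} (hx : 0 < x) (hy : 0 < y)
    (hP : HasDerivAt P d (2 * x * y / (x + y))) :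
    HasDerivAt (wavePotential P x)
      (2 * d * x ^ 2 / (x + y) ^ 4 - 2 * P (2 * x * y / (x + y)) / (x + y) ^ 3) y := by
  have h : 2 * y * x / (y + x) = 2 * x * y / (x + y) := by rw [mul_right_comm, add_comm]
  have := hasDerivAt_wavePotential_fst hy hx (h ▸ hP)
  rw [h, add_comm y x] at this
  exact this.congr_of_eventuallyEq (.of_forall fun t => wavePotential_comm P x t)

lemma potential_energy_coeff_le {c M x y V D : ℝ} (hy : 0 < y) (hyx : y ≤ x) (hc : 0 < c)
    (hV : c ≤ V) (hD : |D| ≤ M) (hM : 8 * M * x ≤ c) :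
    (-1 / x ^ 2 - 2 * y / x ^ 3) * (V / (x + y) ^ 2)
        + (1 / x + y / x ^ 2) * (2 * D * y ^ 2 / (x + y) ^ 4 - 2 * V / (x + y) ^ 3)
        - (1 / x) * (2 * D * x ^ 2 / (x + y) ^ 4 - 2 * V / (x + y) ^ 3)
      ≤ -(c / (2 * (x ^ 2 * (x + y) ^ 2))) := by
  have hx : 0 < x := hy.trans_le hyx
  have hr : 0 < x + y := by positivity
  have key : (-1 / x ^ 2 - 2 * y / x ^ 3) * (V / (x + y) ^ 2)
        + (1 / x + y / x ^ 2) * (2 * D * y ^ 2 / (x + y) ^ 4 - 2 * V / (x + y) ^ 3)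
        - (1 / x) * (2 * D * x ^ 2 / (x + y) ^ 4 - 2 * V / (x + y) ^ 3)
      = (-(1 + 2 * (y / x)) * V + 2 * x * (D * ((1 + y / x) * y ^ 2 - x ^ 2) / (x + y) ^ 2)
          - 2 * y * V / (x + y)) / (x ^ 2 * (x + y) ^ 2) := by
    field_simp
    ring
  have hm0 : 0 ≤ y / x := by positivity
  have hm1 : y / x ≤ 1 := (div_le_one hx).2 hyx
  have hV0 : 0 < V := hc.trans_le hV
  have hM0 : 0 ≤ M := (abs_nonneg D).trans hD
  have h1 : D * ((1 + y / x) * y ^ 2 - x ^ 2) / (x + y) ^ 2 ≤ 2 * M := by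
    rw [div_le_iff₀ (by positivity)]
    have h2 : |(1 + y / x) * y ^ 2 - x ^ 2| ≤ 2 * (x + y) ^ 2 := by
      rw [abs_le]
      constructor
      · nlinarith [mul_nonneg hm0 (sq_nonneg y), mul_pos hx hy]
      · nlinarith [mul_le_mul_of_nonneg_right hm1 (sq_nonneg y), mul_pos hx hy]
    calc D * ((1 + y / x) * y ^ 2 - x ^ 2) ≤ |D| * |(1 + y / x) * y ^ 2 - x ^ 2| := by
          rw [← abs_mul]; exact le_abs_self _
      _ ≤ M * (2 * (x + y) ^ 2) := by gcongr
      _ = 2 * M * (x + y) ^ 2 := by ring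
  have h3 : 0 ≤ 2 * y * V / (x + y) := by positivity
  have h4 := mul_le_mul_of_nonneg_left h1 (by positivity : 0 ≤ 2 * x)
  have h5 := mul_nonneg hm0 hV0.le
  rw [key, ← neg_div, ← div_div (c := x ^ 2 * (x + y) ^ 2), neg_div, ← neg_div]
  gcongr
  linarith

lemma energy_flux_divergence_le {c M x y V D W p q w : ℝ} (hy : 0 < y) (hyx : y ≤ x) (hc : 0 < c)
    (hV : c ≤ V) (hD : |D| ≤ M) (hM : 8 * M * x ≤ c) :
    (-q ^ 2 / x ^ 2 + 2 * q * w / x + (-1 / x ^ 2 - 2 * y / x ^ 3) * (V / (x + y) ^ 2) * W ^ 2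
        + (1 / x + y / x ^ 2) * ((2 * D * y ^ 2 / (x + y) ^ 4 - 2 * V / (x + y) ^ 3) * W ^ 2
          + V / (x + y) ^ 2 * (2 * W * p))) / 2
      + -(p ^ 2 / x ^ 2 + (1 / x + y / x ^ 2) * (2 * p * w)
        + ((2 * D * x ^ 2 / (x + y) ^ 4 - 2 * V / (x + y) ^ 3) * W ^ 2
          + V / (x + y) ^ 2 * (2 * W * q)) / x) / 2
      + (p ^ 2 + q ^ 2 + c * W ^ 2 / (x + y) ^ 2) / (4 * x ^ 2)
      ≤ 5 * (w - V / (x + y) ^ 2 * W) ^ 2 := by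
  have hx : 0 < x := hy.trans_le hyx
  have hr : 0 < x + y := by positivity
  have hS := mul_le_mul_of_nonneg_right (potential_energy_coeff_le hy hyx hc hV hD hM)
    (sq_nonneg W)
  obtain ⟨F, hF⟩ : ∃ F, F = w - V / (x + y) ^ 2 * W := ⟨_, rfl⟩
  obtain rfl : w = V / (x + y) ^ 2 * W + F := by rw [hF]; ring
  have hm0 : 0 ≤ y / x := by positivity
  have hm1 : y / x ≤ 1 := (div_le_one hx).2 hyx
  have hk : (1 + y / x) ^ 2 * F ^ 2 ≤ 4 * F ^ 2 := by
    gcongr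
    nlinarith
  have hp := sq_nonneg (p / x / 2 + (1 + y / x) * F)
  have hq := sq_nonneg (q / x / 2 - F)
  set S := (-1 / x ^ 2 - 2 * y / x ^ 3) * (V / (x + y) ^ 2)
        + (1 / x + y / x ^ 2) * (2 * D * y ^ 2 / (x + y) ^ 4 - 2 * V / (x + y) ^ 3)
        - (1 / x) * (2 * D * x ^ 2 / (x + y) ^ 4 - 2 * V / (x + y) ^ 3) with hSdef
  have e : 5 * (V / (x + y) ^ 2 * W + F - V / (x + y) ^ 2 * W) ^ 2 - 
      ((-q ^ 2 / x ^ 2 + 2 * q * (V / (x + y) ^ 2 * W + F) / x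
        + (-1 / x ^ 2 - 2 * y / x ^ 3) * (V / (x + y) ^ 2) * W ^ 2
        + (1 / x + y / x ^ 2) * ((2 * D * y ^ 2 / (x + y) ^ 4 - 2 * V / (x + y) ^ 3) * W ^ 2
          + V / (x + y) ^ 2 * (2 * W * p))) / 2
      + -(p ^ 2 / x ^ 2 + (1 / x + y / x ^ 2) * (2 * p * (V / (x + y) ^ 2 * W + F))
        + ((2 * D * x ^ 2 / (x + y) ^ 4 - 2 * V / (x + y) ^ 3) * W ^ 2
          + V / (x + y) ^ 2 * (2 * W * q)) / x) / 2
      + (p ^ 2 + q ^ 2 + c * W ^ 2 / (x + y) ^ 2) / (4 * x ^ 2))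
      = (p / x / 2 + (1 + y / x) * F) ^ 2 + (q / x / 2 - F) ^ 2
        + (4 * F ^ 2 - (1 + y / x) ^ 2 * F ^ 2)
        + (-(c / (2 * (x ^ 2 * (x + y) ^ 2))) * W ^ 2 - S * W ^ 2) / 2 := by
    rw [hSdef]
    field_simp
    ring
  linarith

/-- `P` is differentiable on `(0, T)` with continuous derivative `P'`, and satisfies `c ≤ P ≤ K` and
`|P'| ≤ M` there. -/
structure CoefficientBounds (T c K M : ℝ) (P P' : ℝ → ℝ) : Prop where
  hasDerivAt : ∀ x ∈ Ioo 0 T, HasDerivAt P (P' x) x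
  continuousOn_deriv : ContinuousOn P' (Ioo 0 T)
  le : ∀ x ∈ Ioo 0 T, c ≤ P x
  ge : ∀ x ∈ Ioo 0 T, P x ≤ K
  abs_deriv_le : ∀ x ∈ Ioo 0 T, |P' x| ≤ M

lemma continuousOn_comp_harmonicMean {T : ℝ} {f : ℝ → ℝ} (hf : ContinuousOn f (Ioo 0 T)) :
    ContinuousOn (fun z : ℝ × ℝ => f (2 * z.1 * z.2 / (z.1 + z.2))) (Ioo 0 T ×ˢ Ioo 0 T) := by
  refine hf.comp (ContinuousOn.div (by fun_prop) (by fun_prop) fun z hz => ?_)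
    fun z hz => harmonicMean_mem_Ioo hz.1 hz.2
  exact (add_pos hz.1.1 hz.2.1).ne'

lemma CoefficientBounds.continuousOn {T c K M : ℝ} {P P' : ℝ → ℝ}
    (hP : CoefficientBounds T c K M P P') : ContinuousOn P (Ioo 0 T) :=
  fun x hx => (hP.hasDerivAt x hx).continuousAt.continuousWithinAt

lemma continuousOn_wavePotential {T : ℝ} {P : ℝ → ℝ} (hP : ContinuousOn P (Ioo 0 T)) :
    ContinuousOn (fun z : ℝ × ℝ => wavePotential P z.1 z.2) (Ioo 0 T ×ˢ Ioo 0 T) := by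
  refine (continuousOn_comp_harmonicMean hP).div (by fun_prop) fun z hz => ?_
  exact (pow_pos (add_pos hz.1.1 hz.2.1) 2).ne'

lemma integral_lowerTriangle_energy_le {T c K M α β : ℝ} {P P' : ℝ → ℝ} {W p q w : ℝ → ℝ → ℝ}
    (hα : 0 < α) (hαβ : α ≤ β) (hβ : β < T)
    (hW : HasMixedPartialsOn (Ioo 0 T ×ˢ Ioo 0 T) W p q w)
    (hP : CoefficientBounds T c K M P P') (hc : 0 < c) (hM : 8 * M * T ≤ c) :
    ∫ z in lowerTriangle α β,
        (p z.1 z.2 ^ 2 + q z.1 z.2 ^ 2 + c * W z.1 z.2 ^ 2 / (z.1 + z.2) ^ 2) / (4 * z.1 ^ 2)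
      ≤ 5 * (∫ z in lowerTriangle α β,
          (w z.1 z.2 - wavePotential P z.1 z.2 * W z.1 z.2) ^ 2)
        + ∫ t in α..β, (p t t ^ 2 / t + q t t ^ 2 / t + K * W t t ^ 2 / t ^ 3) := by
  have hK := isCompact_lowerTriangle α β
  have hsub := lowerTriangle_subset_square hα hβ
  have hM0 : 0 ≤ M := (abs_nonneg _).trans (hP.abs_deriv_le α ⟨hα, hαβ.trans_lt hβ⟩)
  have hpos : ∀ z ∈ lowerTriangle α β, 0 < z.1 ∧ 0 < z.1 + z.2 := fun z hz =>
    ⟨(hsub hz).1.1, add_pos (hsub hz).1.1 (hsub hz).2.1⟩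
  have hx : ContinuousOn (fun z : ℝ × ℝ => z.1⁻¹) (lowerTriangle α β) :=
    continuousOn_fst.inv₀ fun z hz => (hpos z hz).1.ne'
  have hr : ContinuousOn (fun z : ℝ × ℝ => (z.1 + z.2)⁻¹) (lowerTriangle α β) :=
    (continuousOn_fst.add continuousOn_snd).inv₀ fun z hz => (hpos z hz).2.ne'
  have hWc := hW.continuousOn.mono hsub
  have hpc := hW.continuousOn_fst.mono hsub
  have hqc := hW.continuousOn_snd.mono hsub
  have hwc := hW.continuousOn_mixed.mono hsub
  have hVc := (continuousOn_wavePotential hP.continuousOn).mono hsub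
  have hPc := (continuousOn_comp_harmonicMean hP.continuousOn).mono hsub
  have hDc := (continuousOn_comp_harmonicMean hP.continuousOn_deriv).mono hsub
  obtain ⟨Pm, hPm⟩ : ∃ f : ℝ → ℝ → ℝ, ∀ x y, f x y = P (2 * x * y / (x + y)) :=
    ⟨_, fun _ _ => rfl⟩
  obtain ⟨Dm, hDm⟩ : ∃ f : ℝ → ℝ → ℝ, ∀ x y, f x y = P' (2 * x * y / (x + y)) :=
    ⟨_, fun _ _ => rfl⟩
  simp only [← hPm] at hPc
  simp only [← hDm] at hDc
  set A : ℝ → ℝ → ℝ := fun x y =>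
    (q x y ^ 2 / x + (1 / x + y / x ^ 2) * (wavePotential P x y * W x y ^ 2)) / 2 with hA
  set B : ℝ → ℝ → ℝ := fun x y =>
    -((1 / x + y / x ^ 2) * p x y ^ 2 + wavePotential P x y * W x y ^ 2 / x) / 2 with hB
  set A' : ℝ → ℝ → ℝ := fun x y =>
    (-q x y ^ 2 / x ^ 2 + 2 * q x y * w x y / x
      + (-1 / x ^ 2 - 2 * y / x ^ 3) * (P (2 * x * y / (x + y)) / (x + y) ^ 2) * W x y ^ 2
      + (1 / x + y / x ^ 2) * ((2 * P' (2 * x * y / (x + y)) * y ^ 2 / (x + y) ^ 4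
          - 2 * P (2 * x * y / (x + y)) / (x + y) ^ 3) * W x y ^ 2
        + P (2 * x * y / (x + y)) / (x + y) ^ 2 * (2 * W x y * p x y))) / 2 with hA'
  set B' : ℝ → ℝ → ℝ := fun x y =>
    -(p x y ^ 2 / x ^ 2 + (1 / x + y / x ^ 2) * (2 * p x y * w x y)
      + ((2 * P' (2 * x * y / (x + y)) * x ^ 2 / (x + y) ^ 4
          - 2 * P (2 * x * y / (x + y)) / (x + y) ^ 3) * W x y ^ 2
        + P (2 * x * y / (x + y)) / (x + y) ^ 2 * (2 * W x y * q x y)) / x) / 2 with hB'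
  have cA : ContinuousOn (fun z : ℝ × ℝ => A z.1 z.2) (lowerTriangle α β) := by
    simp only [hA, div_eq_mul_inv, ← inv_pow]
    fun_prop
  have cB : ContinuousOn (fun z : ℝ × ℝ => B z.1 z.2) (lowerTriangle α β) := by
    simp only [hB, div_eq_mul_inv, ← inv_pow]
    fun_prop
  have cA' : ContinuousOn (fun z : ℝ × ℝ => A' z.1 z.2) (lowerTriangle α β) := by
    simp only [hA', ← hPm, ← hDm]
    simp only [div_eq_mul_inv, ← inv_pow]
    fun_prop
  have cB' : ContinuousOn (fun z : ℝ × ℝ => B' z.1 z.2) (lowerTriangle α β) := by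
    simp only [hB', ← hPm, ← hDm]
    simp only [div_eq_mul_inv, ← inv_pow]
    fun_prop
  have cE : ContinuousOn (fun z : ℝ × ℝ => (p z.1 z.2 ^ 2 + q z.1 z.2 ^ 2
      + c * W z.1 z.2 ^ 2 / (z.1 + z.2) ^ 2) / (4 * z.1 ^ 2)) (lowerTriangle α β) := by
    simp only [div_eq_mul_inv, mul_inv, ← inv_pow]
    fun_prop
  have cF : ContinuousOn (fun z : ℝ × ℝ =>
      (w z.1 z.2 - wavePotential P z.1 z.2 * W z.1 z.2) ^ 2) (lowerTriangle α β) := by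
    fun_prop
  have hmem : ∀ x y, (x, y) ∈ lowerTriangle α β → 2 * x * y / (x + y) ∈ Ioo 0 T := fun x y h =>
    harmonicMean_mem_Ioo (hsub h).1 (hsub h).2
  have dA : ∀ x y, (x, y) ∈ lowerTriangle α β → HasDerivAt (fun s => A s y) (A' x y) x := by
    intro x y h
    have hx0 : 0 < x := (hsub h).1.1
    have hy0 : 0 < y := (hsub h).2.1
    have d1 := (hW.hasDerivAt_snd_fst x y (hsub h)).pow 2 |>.div (hasDerivAt_id x) hx0.ne'
    have d2 := ((hasDerivAt_const x (1 : ℝ)).div (hasDerivAt_id x) hx0.ne').add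
      ((hasDerivAt_const x y).div ((hasDerivAt_id x).pow 2) (pow_ne_zero 2 hx0.ne'))
    have d3 := (hasDerivAt_wavePotential_fst hx0 hy0 (hP.hasDerivAt _ (hmem x y h))).mul
      ((hW.hasDerivAt_fst x y (hsub h)).pow 2)
    refine ((d1.add (d2.mul d3)).div_const 2).congr_deriv ?_
    simp only [hA', Pi.add_apply, Pi.mul_apply, Pi.div_apply, Pi.pow_apply, id, wavePotential]
    field_simp
    ring
  have dB : ∀ x y, (x, y) ∈ lowerTriangle α β → HasDerivAt (B x) (B' x y) y := by
    intro x y h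
    have hx0 : 0 < x := (hsub h).1.1
    have hy0 : 0 < y := (hsub h).2.1
    have d2 := ((hasDerivAt_id y).div_const (x ^ 2)).const_add (1 / x)
    have d3 := (hasDerivAt_wavePotential_snd hx0 hy0 (hP.hasDerivAt _ (hmem x y h))).mul
      ((hW.hasDerivAt_snd x y (hsub h)).pow 2)
    have d4 := (hW.hasDerivAt_fst_snd x y (hsub h)).pow 2
    refine (((d2.mul d4).add (d3.div_const x)).neg.div_const 2).congr_deriv ?_
    simp only [hB', Pi.pow_apply, id, wavePotential]
    field_simp
    ring
  have hV0 : ∀ x y, (x, y) ∈ lowerTriangle α β → 0 ≤ wavePotential P x y := fun x y h =>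
    wavePotential_nonneg (hc.le.trans (hP.le _ (hmem x y h)))
  have hflux := integral_diagonal_flux_le hαβ cA cB cA' cB' dA dB
    (fun t ht => by
      have h : (β, t) ∈ lowerTriangle α β := ⟨ht.1, ht.2, le_rfl⟩
      have := hV0 _ _ h
      have := hα.trans_le ht.1
      have := hα.trans_le hαβ
      simp only [hA]
      positivity)
    (fun t ht => by
      have h : (t, α) ∈ lowerTriangle α β := ⟨le_rfl, ht.1, ht.2⟩
      have := hV0 _ _ h
      have := hα.trans_le ht.1
      simp only [hB]
      rw [neg_div, neg_nonpos]
      positivity)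
  have hpt : ∫ z in lowerTriangle α β, ((p z.1 z.2 ^ 2 + q z.1 z.2 ^ 2
        + c * W z.1 z.2 ^ 2 / (z.1 + z.2) ^ 2) / (4 * z.1 ^ 2) + (A' z.1 z.2 + B' z.1 z.2))
      ≤ ∫ z in lowerTriangle α β,
          5 * (w z.1 z.2 - wavePotential P z.1 z.2 * W z.1 z.2) ^ 2 := by
    refine setIntegral_mono_on ((cE.add (cA'.add cB')).integrableOn_compact hK)
      ((cF.integrableOn_compact hK).const_mul 5) hK.measurableSet ?_
    rintro ⟨x, y⟩ h
    have hX := hmem x y h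
    have := energy_flux_divergence_le (W := W x y) (p := p x y) (q := q x y) (w := w x y)
      (hsub h).2.1 h.2.1 hc (hP.le _ hX) (hP.abs_deriv_le _ hX)
      ((mul_le_mul_of_nonneg_left (hsub h).1.2.le (by positivity)).trans hM)
    simp only [hA', hB', wavePotential] at this ⊢
    linarith
  have hABi : IntegrableOn (fun z : ℝ × ℝ => A' z.1 z.2 + B' z.1 z.2) (lowerTriangle α β) :=
    (cA'.add cB').integrableOn_compact hK
  rw [integral_add (cE.integrableOn_compact hK) hABi, integral_const_mul] at hpt
  have hdiag : ∫ t in α..β, -(p t t ^ 2 / t + q t t ^ 2 / t + K * W t t ^ 2 / t ^ 3)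
      ≤ ∫ t in α..β, (B t t - A t t) := by
    have hdc : ∀ {H : ℝ → ℝ → ℝ},
        ContinuousOn (fun z : ℝ × ℝ => H z.1 z.2) (lowerTriangle α β) →
        ContinuousOn (fun t => H t t) (uIcc α β) := fun h =>
      h.comp (f := fun t => (t, t)) (by fun_prop) fun t ht => by
        rw [uIcc_of_le hαβ] at ht
        exact ⟨ht.1, le_rfl, ht.2⟩
    have h1 := hdc cA
    have h2 := hdc cB
    have h3 := hdc hpc
    have h4 := hdc hqc
    have h5 := hdc hWc
    have h6 := hdc (H := fun x _ => x⁻¹) hx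
    refine intervalIntegral.integral_mono_on hαβ (ContinuousOn.intervalIntegrable ?_)
      (h2.sub h1).intervalIntegrable fun t ht => ?_
    · simp only [div_eq_mul_inv, ← inv_pow]
      exact ((((h3.pow 2).mul h6).add ((h4.pow 2).mul h6)).add
        ((continuousOn_const.mul (h5.pow 2)).mul (h6.pow 3))).neg
    · have ht0 : 0 < t := hα.trans_le ht.1
      have htT : t ∈ Ioo 0 T := ⟨ht0, ht.2.trans_lt hβ⟩
      have hm : 2 * t * t / (t + t) = t := by field_simp; norm_num
      have hPK := hP.ge t htT
      have hP0 := hc.trans_le (hP.le t htT)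
      have h1 : 0 ≤ q t t ^ 2 / t / 2 := by positivity
      have h2 : 3 * P t / 8 * (W t t ^ 2 / t ^ 3) ≤ K * (W t t ^ 2 / t ^ 3) := by
        gcongr
        linarith
      have e : B t t - A t t = -(p t t ^ 2 / t + q t t ^ 2 / t / 2
          + 3 * P t / 8 * (W t t ^ 2 / t ^ 3)) := by
        simp only [hA, hB, wavePotential, hm]
        field_simp
        ring
      rw [e, mul_div_assoc]
      linarith
  rw [intervalIntegral.integral_neg] at hdiag
  linarith

lemma ofReal_integral_le_lintegral_ofReal {X : Type*} [MeasurableSpace X] {m : Measure X}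
    (f : X → ℝ) : ENNReal.ofReal (∫ x, f x ∂m) ≤ ∫⁻ x, ENNReal.ofReal (f x) ∂m := by
  by_cases hf : Integrable f m
  · rw [integral_eq_lintegral_pos_part_sub_lintegral_neg_part hf]
    exact (ENNReal.ofReal_le_ofReal (sub_le_self _ ENNReal.toReal_nonneg)).trans
      ENNReal.ofReal_toReal_le
  · simp [integral_undef hf]

lemma lintegral_lowerTriangle_energy_le {T c K M α β : ℝ} {P P' : ℝ → ℝ} {W p q w : ℝ → ℝ → ℝ}
    (hα : 0 < α) (hαβ : α ≤ β) (hβ : β < T)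
    (hW : HasMixedPartialsOn (Ioo 0 T ×ˢ Ioo 0 T) W p q w)
    (hP : CoefficientBounds T c K M P P') (hc : 0 < c) (hM : 8 * M * T ≤ c) :
    ∫⁻ z in lowerTriangle α β, ENNReal.ofReal
        ((p z.1 z.2 ^ 2 + q z.1 z.2 ^ 2 + c * W z.1 z.2 ^ 2 / (z.1 + z.2) ^ 2) / (4 * z.1 ^ 2))
      ≤ 5 * (∫⁻ z in Ioo 0 T ×ˢ Ioo 0 T, ENNReal.ofReal
          ((w z.1 z.2 - wavePotential P z.1 z.2 * W z.1 z.2) ^ 2))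
        + ∫⁻ t in Ioo 0 T,
          ENNReal.ofReal (p t t ^ 2 / t + q t t ^ 2 / t + K * W t t ^ 2 / t ^ 3) := by
  have hK := isCompact_lowerTriangle α β
  have hsub := lowerTriangle_subset_square hα hβ
  have hE : ContinuousOn (fun z : ℝ × ℝ => (p z.1 z.2 ^ 2 + q z.1 z.2 ^ 2
      + c * W z.1 z.2 ^ 2 / (z.1 + z.2) ^ 2) / (4 * z.1 ^ 2)) (lowerTriangle α β) := by
    refine ((((hW.continuousOn_fst.mono hsub).pow 2).add ((hW.continuousOn_snd.mono hsub).pow 2)).add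
      ((continuousOn_const.mul ((hW.continuousOn.mono hsub).pow 2)).div (by fun_prop)
        fun z hz => ?_)).div (by fun_prop) fun z hz => ?_
    · exact (pow_pos (add_pos (hsub hz).1.1 (hsub hz).2.1) 2).ne'
    · have := (hsub hz).1.1
      positivity
  rw [← ofReal_integral_eq_lintegral_ofReal (hE.integrableOn_compact hK) (.of_forall fun z => by
    dsimp only [Pi.zero_apply]; positivity)]
  calc _ ≤ ENNReal.ofReal _ :=
        ENNReal.ofReal_le_ofReal (integral_lowerTriangle_energy_le hα hαβ hβ hW hP hc hM)
    _ ≤ _ := ENNReal.ofReal_add_le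
    _ ≤ _ := by
      rw [ENNReal.ofReal_mul (by norm_num), intervalIntegral.integral_of_le hαβ,
        ENNReal.ofReal_ofNat]
      gcongr
      · exact (ofReal_integral_le_lintegral_ofReal _).trans (lintegral_mono_set hsub)
      · exact (ofReal_integral_le_lintegral_ofReal _).trans
          (lintegral_mono_set fun t ht => ⟨hα.trans ht.1, ht.2.trans_lt hβ⟩)

/-- The half `0 < ν ≤ μ < T` of the square `Ω_T`. -/
def lowerHalf (T : ℝ) : Set (ℝ × ℝ) := {z | 0 < z.2 ∧ z.2 ≤ z.1 ∧ z.1 < T}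

lemma measurableSet_lowerHalf (T : ℝ) : MeasurableSet (lowerHalf T) :=
  (measurableSet_lt measurable_const measurable_snd).inter
    ((measurableSet_le measurable_snd measurable_fst).inter
      (measurableSet_lt measurable_fst measurable_const))

lemma lowerHalf_subset_iUnion (T : ℝ) :
    lowerHalf T ⊆ ⋃ n : ℕ, lowerTriangle (T / (n + 2)) (T - T / (n + 2)) := by
  rintro ⟨x, y⟩ ⟨h1, h2, h3⟩
  simp only at h1 h2 h3
  have hT : 0 < T := by linarith
  have hlim : Filter.Tendsto (fun n : ℕ => T / ((n : ℝ) + 2)) Filter.atTop (nhds 0) :=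
    Filter.Tendsto.div_atTop tendsto_const_nhds
      (Filter.tendsto_atTop_add_const_right _ _ tendsto_natCast_atTop_atTop)
  obtain ⟨n, hn⟩ := (hlim.eventually (gt_mem_nhds (lt_min h1 (sub_pos.2 h3)))).exists
  rw [lt_min_iff] at hn
  exact mem_iUnion.2 ⟨n, hn.1.le, h2, by linarith [hn.2]⟩

lemma setLIntegral_lowerHalf_le {T : ℝ} (hT : 0 < T) {f : ℝ × ℝ → ℝ≥0∞} {b : ℝ≥0∞}
    (h : ∀ α β, 0 < α → α ≤ β → β < T → ∫⁻ z in lowerTriangle α β, f z ≤ b) :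
    ∫⁻ z in lowerHalf T, f z ≤ b := by
  refine (lintegral_mono_set (lowerHalf_subset_iUnion T)).trans ?_
  have hmono : Monotone fun n : ℕ => T / ((n : ℝ) + 2) |> fun a => lowerTriangle a (T - a) := by
    intro m n hmn z hz
    have : T / ((n : ℝ) + 2) ≤ T / ((m : ℝ) + 2) := by gcongr
    exact ⟨this.trans hz.1, hz.2.1, hz.2.2.trans (by linarith)⟩
  rw [setLIntegral_iUnion_of_directed _ hmono.directed_le]
  refine iSup_le fun n => h _ _ (by positivity) ?_ ?_
  · have : T / ((n : ℝ) + 2) ≤ T / 2 := by gcongr; linarith [n.cast_nonneg (α := ℝ)]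
    linarith
  · have : 0 < T / ((n : ℝ) + 2) := by positivity
    linarith

lemma energyDensity_le {T l c x y W p q : ℝ} (hy : 0 < y) (hyx : y ≤ x) (hxT : x ≤ T)
    (hl : 0 ≤ l) (hc : 0 < c) :
    ((x + y) ^ 2)⁻¹ * (x * p ^ 2 + y * q ^ 2) + ((x + y) ^ 3)⁻¹ * l * W ^ 2
      ≤ T * (4 + 4 * l / c) * ((p ^ 2 + q ^ 2 + c * W ^ 2 / (x + y) ^ 2) / (4 * x ^ 2)) := by
  have hx : 0 < x := hy.trans_le hyx
  have hr : 0 < x + y := by positivity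
  have hT : 0 < T := hx.trans_le hxT
  have h1 : ((x + y) ^ 2)⁻¹ * (x * p ^ 2 + y * q ^ 2) ≤ (x ^ 2)⁻¹ * (T * p ^ 2 + T * q ^ 2) := by
    gcongr
    · linarith
    · linarith
  have h2 : ((x + y) ^ 3)⁻¹ * l * W ^ 2 ≤ T * l * W ^ 2 / ((x + y) ^ 2 * x ^ 2) := by
    have : ((x + y) ^ 3)⁻¹ ≤ T / ((x + y) ^ 2 * x ^ 2) := by
      rw [← one_div, div_le_div_iff₀ (by positivity) (by positivity)]
      nlinarith [mul_le_mul hxT (by linarith : x ≤ x + y) hx.le hT.le, pow_pos hr 2]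
    calc _ ≤ T / ((x + y) ^ 2 * x ^ 2) * l * W ^ 2 := by gcongr
      _ = _ := by ring
  have h3 : 0 ≤ T * (4 * l / c) * ((p ^ 2 + q ^ 2) / (4 * x ^ 2))
      + T * 4 * (c * W ^ 2 / (x + y) ^ 2 / (4 * x ^ 2)) := by positivity
  have e : T * (4 + 4 * l / c) * ((p ^ 2 + q ^ 2 + c * W ^ 2 / (x + y) ^ 2) / (4 * x ^ 2))
      = (x ^ 2)⁻¹ * (T * p ^ 2 + T * q ^ 2) + T * l * W ^ 2 / ((x + y) ^ 2 * x ^ 2)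
        + (T * (4 * l / c) * ((p ^ 2 + q ^ 2) / (4 * x ^ 2))
          + T * 4 * (c * W ^ 2 / (x + y) ^ 2 / (4 * x ^ 2))) := by
    field_simp
    ring
  linarith

lemma lintegral_lowerHalf_energy_le {T c K M l : ℝ} {P P' : ℝ → ℝ} {W p q w : ℝ → ℝ → ℝ}
    (hT : 0 < T) (hl : 0 ≤ l) (hW : HasMixedPartialsOn (Ioo 0 T ×ˢ Ioo 0 T) W p q w)
    (hP : CoefficientBounds T c K M P P') (hc : 0 < c) (hM : 8 * M * T ≤ c) :
    ∫⁻ z in lowerHalf T, ENNReal.ofReal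
        (((z.1 + z.2) ^ 2)⁻¹ * (z.1 * p z.1 z.2 ^ 2 + z.2 * q z.1 z.2 ^ 2)
          + ((z.1 + z.2) ^ 3)⁻¹ * l * W z.1 z.2 ^ 2)
      ≤ ENNReal.ofReal (T * (4 + 4 * l / c)) *
        (5 * (∫⁻ z in Ioo 0 T ×ˢ Ioo 0 T, ENNReal.ofReal
            ((w z.1 z.2 - wavePotential P z.1 z.2 * W z.1 z.2) ^ 2))
          + ∫⁻ t in Ioo 0 T,
            ENNReal.ofReal (p t t ^ 2 / t + q t t ^ 2 / t + K * W t t ^ 2 / t ^ 3)) := by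
  refine (setLIntegral_mono' (measurableSet_lowerHalf T) fun z hz =>
    ENNReal.ofReal_le_ofReal (energyDensity_le hz.1 hz.2.1 hz.2.2.le hl hc)).trans ?_
  simp_rw [ENNReal.ofReal_mul (show 0 ≤ T * (4 + 4 * l / c) by positivity)]
  rw [lintegral_const_mul' _ _ ENNReal.ofReal_ne_top]
  gcongr
  exact setLIntegral_lowerHalf_le hT fun α β hα hαβ hβ =>
    lintegral_lowerTriangle_energy_le hα hαβ hβ hW hP hc hM

lemma setLIntegral_comp_swap (f : ℝ × ℝ → ℝ≥0∞) (s : Set (ℝ × ℝ)) :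
    ∫⁻ z in Prod.swap ⁻¹' s, f z.swap = ∫⁻ z in s, f z :=
  (Measure.measurePreserving_swap (μ := (volume : Measure ℝ)) (ν := (volume : Measure ℝ))
    ).setLIntegral_comp_preimage_emb MeasurableEquiv.prodComm.measurableEmbedding f s

lemma lintegral_square_energy_le {T c K M l : ℝ} {P P' : ℝ → ℝ} {W p q w : ℝ → ℝ → ℝ}
    (hT : 0 < T) (hl : 0 ≤ l) (hW : HasMixedPartialsOn (Ioo 0 T ×ˢ Ioo 0 T) W p q w)
    (hP : CoefficientBounds T c K M P P') (hc : 0 < c) (hM : 8 * M * T ≤ c) :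
    ∫⁻ z in Ioo 0 T ×ˢ Ioo 0 T, ENNReal.ofReal
        (((z.1 + z.2) ^ 2)⁻¹ * (z.1 * p z.1 z.2 ^ 2 + z.2 * q z.1 z.2 ^ 2)
          + ((z.1 + z.2) ^ 3)⁻¹ * l * W z.1 z.2 ^ 2)
      ≤ 2 * ENNReal.ofReal (T * (4 + 4 * l / c)) *
        (5 * (∫⁻ z in Ioo 0 T ×ˢ Ioo 0 T, ENNReal.ofReal
            ((w z.1 z.2 - wavePotential P z.1 z.2 * W z.1 z.2) ^ 2))
          + ∫⁻ t in Ioo 0 T,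
            ENNReal.ofReal (p t t ^ 2 / t + q t t ^ 2 / t + K * W t t ^ 2 / t ^ 3)) := by
  have hsub : Ioo 0 T ×ˢ Ioo 0 T ⊆ lowerHalf T ∪ Prod.swap ⁻¹' lowerHalf T := by
    rintro ⟨x, y⟩ ⟨hx, hy⟩
    rcases le_total y x with h | h
    · exact .inl ⟨hy.1, h, hx.2⟩
    · exact .inr ⟨hx.1, h, hy.2⟩
  have h1 := lintegral_lowerHalf_energy_le hT hl hW hP hc hM
  have h2 := lintegral_lowerHalf_energy_le hT hl hW.swap hP hc hM
  have hsrc : ∫⁻ z in Ioo 0 T ×ˢ Ioo 0 T, ENNReal.ofReal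
        ((w z.2 z.1 - wavePotential P z.1 z.2 * W z.2 z.1) ^ 2)
      = ∫⁻ z in Ioo 0 T ×ˢ Ioo 0 T, ENNReal.ofReal
        ((w z.1 z.2 - wavePotential P z.1 z.2 * W z.1 z.2) ^ 2) := by
    rw [← setLIntegral_comp_swap, preimage_swap_prod]
    simp only [Prod.fst_swap, Prod.snd_swap, wavePotential_comm P]
  rw [hsrc, ← setLIntegral_comp_swap] at h2
  simp only [Prod.fst_swap, Prod.snd_swap] at h2
  rw [mul_assoc, two_mul]
  refine (lintegral_mono_set hsub).trans ((lintegral_union_le _ _ _).trans (add_le_add h1 ?_))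
  refine le_of_eq_of_le (lintegral_congr fun z => ?_) (h2.trans_eq ?_)
  · rw [add_comm z.2 z.1, add_comm (z.2 * _)]
  · simp_rw [fun t => add_comm (q t t ^ 2 / t) (p t t ^ 2 / t)]

lemma ContDiffOn.hasDerivAt_diagonal {s : Set (ℝ × ℝ)} (hs : IsOpen s) {W : ℝ → ℝ → ℝ}
    (hW : ContDiffOn ℝ 2 (fun z : ℝ × ℝ => W z.1 z.2) s) {t : ℝ} (ht : (t, t) ∈ s) :
    HasDerivAt (fun r => W r r) (deriv (fun a => W a t) t + deriv (W t) t) t := by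
  have hd := ((hW.differentiableOn (by norm_num) _ ht).differentiableAt (hs.mem_nhds ht)).hasFDerivAt
  have h0 := HasFDerivAt.comp_hasDerivAt (f := fun r => (r, r)) t hd
    ((hasDerivAt_id t).prodMk (hasDerivAt_id t))
  have h1 := HasFDerivAt.comp_hasDerivAt (f := fun r => (r, t)) t hd
    ((hasDerivAt_id t).prodMk (hasDerivAt_const t t))
  have h2 := HasFDerivAt.comp_hasDerivAt (f := fun r => (t, r)) t hd
    ((hasDerivAt_const t t).prodMk (hasDerivAt_id t))
  have e1 := HasDerivAt.deriv h1
  have e2 := HasDerivAt.deriv h2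
  simp only [Function.comp_def] at h0 e1 e2
  rw [e1, e2, ← map_add]
  simpa using h0

lemma diagonal_density_le {K t a p q : ℝ} (hK : 0 ≤ K) (ht : 0 < t) (ht1 : t ≤ 1) :
    p ^ 2 / t + q ^ 2 / t + K * a ^ 2 / t ^ 3 ≤ (13 + K) * ((t ^ (-(3 / 2) : ℝ) * a) ^ 2
      + ((-(3 / 2) * t ^ (-(3 / 2) - 1 : ℝ) * a + t ^ (-(3 / 2) : ℝ) * (p + q)) ^ 2
        + (t ^ (-(3 / 2) : ℝ) * p) ^ 2)) := by
  have hs : (t ^ (-(3 / 2) : ℝ)) ^ 2 = (t ^ 3)⁻¹ := by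
    rw [← Real.rpow_natCast, ← Real.rpow_mul ht.le, ← Real.rpow_natCast, ← Real.rpow_neg ht.le]
    norm_num
  rw [Real.rpow_sub_one ht.ne']
  set s := t ^ (-(3 / 2) : ℝ)
  obtain ⟨h, hh⟩ : ∃ h, h = -(3 / 2) * (s / t) * a + s * (p + q) := ⟨_, rfl⟩
  have e1 : p ^ 2 / t = t ^ 2 * (s * p) ^ 2 := by
    rw [mul_pow, hs]; field_simp
  have e2 : (p + q) ^ 2 / t = (t * h + 3 / 2 * (s * a)) ^ 2 := by
    have : t * h + 3 / 2 * (s * a) = t * s * (p + q) := by rw [hh]; field_simp; ring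
    rw [this, mul_pow, mul_pow, hs]; field_simp
  have e3 : K * a ^ 2 / t ^ 3 = K * (s * a) ^ 2 := by
    rw [mul_pow, hs]; field_simp
  have e4 : q ^ 2 / t ≤ 2 * ((p + q) ^ 2 / t) + 2 * (p ^ 2 / t) := by
    rw [← mul_div_assoc, ← mul_div_assoc, ← add_div]
    gcongr
    nlinarith [sq_nonneg (p + (p + q))]
  have ht2 : t ^ 2 ≤ 1 := pow_le_one₀ ht.le ht1
  have e5 : (t * h + 3 / 2 * (s * a)) ^ 2 ≤ 2 * h ^ 2 + 9 / 2 * (s * a) ^ 2 := by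
    nlinarith [sq_nonneg (t * h - 3 / 2 * (s * a)), mul_le_mul_of_nonneg_right ht2 (sq_nonneg h)]
  have e6 := mul_le_mul_of_nonneg_right ht2 (sq_nonneg (s * p))
  rw [← hh]
  have := mul_nonneg hK (sq_nonneg h)
  have := mul_nonneg hK (sq_nonneg (s * p))
  nlinarith [sq_nonneg h, sq_nonneg (s * p), sq_nonneg (s * a)]

lemma lintegral_diagonal_le {T K : ℝ} (hT : T ≤ 1) (hK : 0 ≤ K) {W p q : ℝ → ℝ → ℝ}
    (hd : ∀ t ∈ Ioo 0 T, HasDerivAt (fun r => W r r) (p t t + q t t) t) :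
    ∫⁻ t in Ioo 0 T, ENNReal.ofReal (p t t ^ 2 / t + q t t ^ 2 / t + K * W t t ^ 2 / t ^ 3)
      ≤ ENNReal.ofReal (13 + K) * (sobNormSq T 2 (3 / 2) (fun t => W t t)
        + sobNormSq T 2 (3 / 2) (fun t => p t t)) := by
  have hderiv : ∀ t ∈ Ioo 0 T, deriv (fun r => r ^ (-(3 / 2) : ℝ) * W r r) t
      = -(3 / 2) * t ^ (-(3 / 2) - 1 : ℝ) * W t t + t ^ (-(3 / 2) : ℝ) * (p t t + q t t) :=
    fun t ht => ((Real.hasDerivAt_rpow_const (.inl ht.1.ne')).mul (hd t ht)).deriv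
  have hm : AEMeasurable (fun t => ENNReal.ofReal ((t ^ (-(3 / 2) : ℝ) * W t t) ^ 2))
      (volume.restrict (Ioo 0 T)) := by
    refine ENNReal.measurable_ofReal.comp_aemeasurable (AEMeasurable.pow_const ?_ 2)
    refine ContinuousOn.aemeasurable (fun t ht => ?_) measurableSet_Ioo
    exact ((Real.hasDerivAt_rpow_const (.inl ht.1.ne')).mul
      (hd t ht)).continuousAt.continuousWithinAt
  have hm' : Measurable fun t =>
      ENNReal.ofReal (deriv (fun r => r ^ (-(3 / 2) : ℝ) * W r r) t ^ 2) :=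
    ENNReal.measurable_ofReal.comp ((measurable_deriv _).pow_const 2)
  calc _ ≤ ∫⁻ t in Ioo 0 T, ENNReal.ofReal (13 + K) *
        (ENNReal.ofReal ((t ^ (-(3 / 2) : ℝ) * W t t) ^ 2)
          + (ENNReal.ofReal (deriv (fun r => r ^ (-(3 / 2) : ℝ) * W r r) t ^ 2)
            + ENNReal.ofReal ((t ^ (-(3 / 2) : ℝ) * p t t) ^ 2))) := by
        refine setLIntegral_mono' measurableSet_Ioo fun t ht => ?_
        rw [hderiv t ht, ← ENNReal.ofReal_add (by positivity) (by positivity),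
          ← ENNReal.ofReal_add (by positivity) (by positivity),
          ← ENNReal.ofReal_mul (by positivity)]
        exact ENNReal.ofReal_le_ofReal (diagonal_density_le hK ht.1 (ht.2.le.trans hT))
    _ ≤ _ := by
        rw [lintegral_const_mul' _ _ ENNReal.ofReal_ne_top, lintegral_add_left' hm,
          lintegral_add_left hm', ← add_assoc]
        simp only [sobNormSq, Finset.sum_range_succ, Finset.sum_range_zero, zero_add,
          iteratedDeriv_zero, iteratedDeriv_one]
        exact mul_le_mul' le_rfl (add_le_add le_self_add (le_self_add.trans le_self_add))

lemma exists_coefficientBounds {ε c : ℝ} (hε : 0 < ε) {P : ℝ → ℝ} (hP : ContDiffOn ℝ 1 P (Ico 0 ε))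
    (hc : ∀ x ∈ Ico (0 : ℝ) ε, c ≤ P x) :
    ∃ K M : ℝ, 0 ≤ K ∧ 0 ≤ M ∧
      ∀ T, T ≤ ε / 2 → CoefficientBounds T c K M P (deriv P) := by
  have hsub : Icc 0 (ε / 2) ⊆ Ico 0 ε := Icc_subset_Ico_right (by linarith)
  obtain ⟨K, hK⟩ := isCompact_Icc.exists_bound_of_continuousOn (hP.continuousOn.mono hsub)
  obtain ⟨M, hM⟩ := isCompact_Icc.exists_bound_of_continuousOn
    ((hP.continuousOn_derivWithin (uniqueDiffOn_Ico 0 ε) le_rfl).mono hsub)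
  have h0 : (0 : ℝ) ∈ Icc 0 (ε / 2) := ⟨le_rfl, by positivity⟩
  refine ⟨K, M, (norm_nonneg _).trans (hK 0 h0), (norm_nonneg _).trans (hM 0 h0), fun T hT => ?_⟩
  have hlt : T < ε := by linarith
  have hIoo : Ioo 0 T ⊆ Ioo 0 ε := Ioo_subset_Ioo_right hlt.le
  have hIcc : Ioo 0 T ⊆ Icc 0 (ε / 2) := fun x hx => ⟨hx.1.le, hx.2.le.trans hT⟩
  have hnhds : ∀ x ∈ Ioo 0 T, Ico 0 ε ∈ nhds x := fun x hx =>
    Ico_mem_nhds hx.1 (hx.2.trans hlt)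
  refine ⟨fun x hx => ?_, ?_, fun x hx => hc x (hsub (hIcc hx)),
    fun x hx => (le_abs_self _).trans (hK x (hIcc hx)), fun x hx => ?_⟩
  · exact ((hP.differentiableOn one_ne_zero x (hsub (hIcc hx))).differentiableAt
      (hnhds x hx)).hasDerivAt
  · exact ((hP.mono Ioo_subset_Ico_self).continuousOn_deriv_of_isOpen isOpen_Ioo le_rfl).mono hIoo
  · rw [← derivWithin_of_mem_nhds (hnhds x hx)]
    exact hM x (hIcc hx)

/-- scalar (eigenfunction-mode) bulk energy estimate for
`(μ+ν)² ∂_μ∂_ν W − (λ φ(2μν/(μ+ν)) + B(2μν/(μ+ν))) W = G`: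
`∫_{Ω_T} [(μ+ν)^{-2}(μ (∂_μ W)² + ν (∂_ν W)²) + (μ+ν)^{-3}(λ+1) W²]
  ≤ C T (‖q₁‖_{2,3/2}² + ‖q₂‖_{2,3/2}² + |||G|||_{0,2}²)`. -/
theorem stmt8 (ε : ℝ) (hε : 0 < ε) (φ B : ℝ → ℝ)
    (hφ : ContDiffOn ℝ (⊤ : ℕ∞) φ (Ico 0 ε)) (hB : ContDiffOn ℝ (⊤ : ℕ∞) B (Ico 0 ε))
    (lam c₀ : ℝ) (hlam : 0 ≤ lam) (hc₀ : 0 < c₀)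
    (hφpos : ∀ x ∈ Ico (0 : ℝ) ε, 0 < φ x)
    (hcoer : ∀ x ∈ Ico (0 : ℝ) ε, c₀ ≤ lam * φ x + B x) :
    ∃ T₀ C : ℝ, 0 < T₀ ∧ T₀ ≤ ε / 2 ∧ 0 < C ∧
      ∀ T : ℝ, 0 < T → T ≤ T₀ →
      ∀ G : ℝ → ℝ → ℝ, Measurable (fun p : ℝ × ℝ => G p.1 p.2) →
        srcNormSq T 2 G ≠ ⊤ →
      ∀ W : ℝ → ℝ → ℝ,
        ContDiffOn ℝ (⊤ : ℕ∞) (fun p : ℝ × ℝ => W p.1 p.2) (Ioo 0 T ×ˢ Ioo 0 T) →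
        (∀ μ ∈ Ioo (0 : ℝ) T, ∀ ν ∈ Ioo (0 : ℝ) T,
          (μ + ν) ^ 2 * deriv (fun a => deriv (fun b => W a b) ν) μ
            - (lam * φ (2 * μ * ν / (μ + ν)) + B (2 * μ * ν / (μ + ν))) * W μ ν = G μ ν) →
        sobNormSq T 2 (3 / 2) (fun t => W t t) ≠ ⊤ →
        sobNormSq T 2 (3 / 2) (fun t => deriv (fun a => W a t) t) ≠ ⊤ →
        (∫⁻ p in Ioo (0 : ℝ) T ×ˢ Ioo (0 : ℝ) T,
            ENNReal.ofReal ((p.1 + p.2) ^ (-2 : ℝ) *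
                (p.1 * (deriv (fun a => W a p.2) p.1) ^ 2 + p.2 * (deriv (W p.1) p.2) ^ 2)
              + (p.1 + p.2) ^ (-3 : ℝ) * (lam + 1) * (W p.1 p.2) ^ 2))
          ≤ ENNReal.ofReal (C * T) *
            (sobNormSq T 2 (3 / 2) (fun t => W t t)
              + sobNormSq T 2 (3 / 2) (fun t => deriv (fun a => W a t) t)
              + srcNormSq T 2 G) := by
  have hP : ContDiffOn ℝ 1 (fun x => lam * φ x + B x) (Ico 0 ε) :=
    ((contDiffOn_const.mul hφ).add hB).of_le (by norm_cast)
  obtain ⟨K, M, hK, hM, hbd⟩ := exists_coefficientBounds hε hP hcoer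
  have hK1 : 0 < 4 + 4 * (lam + 1) / c₀ := by positivity
  refine ⟨min (ε / 2) (min 1 (c₀ / (8 * (M + 1)))), 2 * (4 + 4 * (lam + 1) / c₀) * (18 + K),
    by positivity, min_le_left _ _, by positivity, fun T hT hTT₀ G _ _ W hW hpde _ _ => ?_⟩
  have hTε : T ≤ ε / 2 := hTT₀.trans (min_le_left _ _)
  have hT1 : T ≤ 1 := hTT₀.trans ((min_le_right _ _).trans (min_le_left _ _))
  have hMT : 8 * M * T ≤ c₀ := by
    have := hTT₀.trans ((min_le_right _ _).trans (min_le_right _ _))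
    rw [le_div_iff₀ (by positivity)] at this
    linarith
  have hopen : IsOpen (Ioo 0 T ×ˢ Ioo 0 T) := isOpen_Ioo.prod isOpen_Ioo
  have hW2 := hW.of_le (m := 2) (by norm_cast)
  have hmain := lintegral_square_energy_le hT (by positivity : 0 ≤ lam + 1)
    (hW2.hasMixedPartialsOn hopen) (hbd T hTε) hc₀ hMT
  have hdiag := lintegral_diagonal_le hT1 hK
    (p := fun x y => deriv (fun a => W a y) x) (q := fun x y => deriv (W x) y)
    fun t ht => hW2.hasDerivAt_diagonal hopen ⟨ht, ht⟩
  have hsrc : ∫⁻ z in Ioo 0 T ×ˢ Ioo 0 T, ENNReal.ofReal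
      ((deriv (fun t => deriv (fun r => W t r) z.2) z.1
        - wavePotential (fun x => lam * φ x + B x) z.1 z.2 * W z.1 z.2) ^ 2)
      = srcNormSq T 2 G := by
    refine setLIntegral_congr_fun hopen.measurableSet fun z hz => ?_
    have hr : 0 < z.1 + z.2 := add_pos hz.1.1 hz.2.1
    have hrpow : (z.1 + z.2) ^ (-(2 * 2) : ℝ) = ((z.1 + z.2) ^ 4)⁻¹ := by
      rw [Real.rpow_neg hr.le]
      norm_cast
    rw [hrpow, ← hpde z.1 hz.1 z.2 hz.2, wavePotential]
    congr 1
    field_simp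
  have hlhs : ∀ z ∈ Ioo 0 T ×ˢ Ioo 0 T, (z.1 + z.2) ^ (-2 : ℝ) = ((z.1 + z.2) ^ 2)⁻¹ ∧
      (z.1 + z.2) ^ (-3 : ℝ) = ((z.1 + z.2) ^ 3)⁻¹ := fun z hz => by
    have hr : 0 < z.1 + z.2 := add_pos hz.1.1 hz.2.1
    constructor <;> · rw [Real.rpow_neg hr.le]; norm_cast
  rw [hsrc] at hmain
  rw [setLIntegral_congr_fun hopen.measurableSet fun z hz => by
    rw [(hlhs z hz).1, (hlhs z hz).2]]
  refine hmain.trans ?_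
  set N₁ := sobNormSq T 2 (3 / 2) (fun t => W t t)
  set N₂ := sobNormSq T 2 (3 / 2) (fun t => deriv (fun a => W a t) t)
  set N₃ := srcNormSq T 2 G
  have h5 : (5 : ℝ≥0∞) ≤ ENNReal.ofReal (18 + K) := by
    rw [← ENNReal.ofReal_ofNat]
    exact ENNReal.ofReal_le_ofReal (by linarith)
  have h13 : ENNReal.ofReal (13 + K) ≤ ENNReal.ofReal (18 + K) :=
    ENNReal.ofReal_le_ofReal (by linarith)
  calc _ ≤ 2 * ENNReal.ofReal (T * (4 + 4 * (lam + 1) / c₀)) *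
        (ENNReal.ofReal (18 + K) * N₃ + ENNReal.ofReal (18 + K) * (N₁ + N₂)) := by
        gcongr
        exact hdiag.trans (by gcongr)
    _ = _ := by
      rw [← mul_add, add_comm N₃, ← mul_assoc, ← ENNReal.ofReal_ofNat,
        ← ENNReal.ofReal_mul (by norm_num), ← ENNReal.ofReal_mul (by positivity)]
      congr 2
      ring
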